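/- Let G be a finite abelian group of exponent n, and let S be a sequence over G containing no tiny zero-sum subsequence, with k(S) = ρ(G), and of minimal length among all sequences with these two properties. Then for every divisor d > 1 of n and every divisor d' > 1 of d, the number of elements of order d occurring in S is at most η_{(d',d)}(G) − 1. -/

import Mathlib

open Multiset Finset

/-- The cross number of a sequence (multiset) over an additive group:
    the sum of the reciprocals of the orders of its elements. -/
noncomputable def crossNum {G : Type*} [AddCommGroup G] (S : Multiset G) : ℝ :=
  (S.map fun g => (1 : ℝ) / (addOrderOf g : ℝ)).sum

/-- A tiny zero-sum sequence: non-empty, zero sum, cross number at most 1. -/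
def IsTinyZS {G : Type*} [AddCommGroup G] (S' : Multiset G) : Prop :=
  S' ≠ 0 ∧ S'.sum = 0 ∧ crossNum S' ≤ 1

/-- `tC G` : the smallest `t ≥ 1` such that every sequence over `G` of length `≥ t`
    contains a tiny zero-sum subsequence. -/
noncomputable def tC (G : Type*) [AddCommGroup G] : ℕ :=
  sInf {t : ℕ | 0 < t ∧ ∀ S : Multiset G, t ≤ Multiset.card S → ∃ S' ≤ S, IsTinyZS S'}

/-- `etaC G` : the smallest `t ≥ 1` such that every sequence over `G` of length `≥ t`
    contains a non-empty zero-sum subsequence of length at most `exp(G)`. -/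
noncomputable def etaC (G : Type*) [AddCommGroup G] : ℕ :=
  sInf {t : ℕ | 0 < t ∧ ∀ S : Multiset G, t ≤ Multiset.card S →
    ∃ S' ≤ S, S' ≠ 0 ∧ S'.sum = 0 ∧ Multiset.card S' ≤ AddMonoid.exponent G}

/-- `etaDD G d' d` : the smallest `t ≥ 1` such that every sequence over
    `G_d = {x : G | d • x = 0}` of length `≥ t` contains a non-empty subsequence of length
    at most `d'` whose sum lies in `G_{d/d'}`. -/
noncomputable def etaDD (G : Type*) [AddCommGroup G] (d' d : ℕ) : ℕ :=
  sInf {t : ℕ | 0 < t ∧ ∀ S : Multiset G, (∀ g ∈ S, d • g = 0) → t ≤ Multiset.card S →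
    ∃ S' ≤ S, S' ≠ 0 ∧ Multiset.card S' ≤ d' ∧ (d / d') • S'.sum = 0}

/-- `rhoC G` : the maximum of the cross numbers of sequences over `G` containing
    no tiny zero-sum subsequence. -/
noncomputable def rhoC (G : Type*) [AddCommGroup G] : ℝ :=
  sSup {x : ℝ | ∃ S : Multiset G, (¬ ∃ S' ≤ S, IsTinyZS S') ∧ crossNum S = x}

/-- `maxPF n = P⁺(n)`, the greatest prime divisor of `n`, with `P⁺(1) = 1`. -/
def maxPF (n : ℕ) : ℕ := if n = 1 then 1 else n.primeFactors.sup id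

/-- `G` is a finite abelian group of rank `r`, i.e. `G ≅ C_{n₁} ⊕ ⋯ ⊕ C_{n_r}` with
    `1 < n₁ ∣ ⋯ ∣ n_r`. -/
def HasRank (G : Type*) [AddCommGroup G] (r : ℕ) : Prop :=
  ∃ n : Fin r → ℕ, (∀ i, 1 < n i) ∧ (∀ i j : Fin r, i ≤ j → n i ∣ n j) ∧
    Nonempty (G ≃+ ((i : Fin r) → ZMod (n i)))

theorem crossNum_add {G : Type*} [AddCommGroup G] (S T : Multiset G) :
    crossNum (S + T) = crossNum S + crossNum T := by
  simp [crossNum]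

theorem crossNum_cons {G : Type*} [AddCommGroup G] (g : G) (S : Multiset G) :
    crossNum (g ::ₘ S) = 1 / (addOrderOf g : ℝ) + crossNum S := by
  simp [crossNum]

theorem crossNum_eq_of_addOrderOf_eq {G : Type*} [AddCommGroup G] {d : ℕ} {S : Multiset G}
    (h : ∀ g ∈ S, addOrderOf g = d) : crossNum S = Multiset.card S * (1 / (d : ℝ)) := by
  rw [crossNum, Multiset.map_congr rfl fun g hg => by rw [h g hg]]
  simp

theorem crossNum_le_card {G : Type*} [AddCommGroup G] (S : Multiset G) :
    crossNum S ≤ Multiset.card S := by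
  induction S using Multiset.induction_on with
  | empty => simp [crossNum]
  | cons g S ih =>
    have h : 1 / (addOrderOf g : ℝ) ≤ 1 := by simpa using Nat.cast_inv_le_one (addOrderOf g)
    rw [crossNum_cons, Multiset.card_cons]
    push_cast
    linarith

/-- Pigeonhole: a sequence of length at least `|G| * m` repeats some element `m` times. -/
theorem exists_replicate_le_of_card_mul_le {G : Type*} [AddCommGroup G] [Fintype G] (m : ℕ)
    {S : Multiset G} (h : Fintype.card G * m ≤ Multiset.card S) :
    ∃ g, Multiset.replicate m g ≤ S := by
  classical
  by_contra! hc
  have hlt : ∀ g, S.count g < m := fun g => by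
    have := hc g
    rwa [← Multiset.le_count_iff_replicate_le, not_le] at this
  have hsum : ∑ g : G, S.count g = Multiset.card S :=
    Multiset.sum_count_eq_card fun _ _ => Finset.mem_univ _
  have : ∑ g : G, S.count g < ∑ _g : G, m :=
    Finset.sum_lt_sum_of_nonempty Finset.univ_nonempty fun g _ => hlt g
  simp at this
  omega

theorem isTinyZS_replicate_addOrderOf {G : Type*} [AddCommGroup G] [Finite G] (g : G) :
    IsTinyZS (Multiset.replicate (addOrderOf g) g) := by
  have hpos := addOrderOf_pos g
  refine ⟨fun h => ?_, by simp [addOrderOf_nsmul_eq_zero], ?_⟩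
  · have := congrArg Multiset.card h
    rw [Multiset.card_replicate, Multiset.card_zero] at this
    omega
  · rw [crossNum_eq_of_addOrderOf_eq fun x hx => by rw [Multiset.eq_of_mem_replicate hx],
      Multiset.card_replicate, mul_one_div_cancel (by positivity)]

theorem bddAbove_crossNum {G : Type*} [AddCommGroup G] [Fintype G] :
    BddAbove {x : ℝ | ∃ S : Multiset G, (¬ ∃ S' ≤ S, IsTinyZS S') ∧ crossNum S = x} := by
  refine ⟨((Fintype.card G * Fintype.card G : ℕ) : ℝ), ?_⟩
  rintro _ ⟨S, hS, rfl⟩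
  refine (crossNum_le_card S).trans (Nat.cast_le.mpr ?_)
  by_contra! hlt
  obtain ⟨g, hg⟩ := exists_replicate_le_of_card_mul_le _ hlt.le
  have hle : addOrderOf g ≤ Fintype.card G := addOrderOf_le_card_univ
  exact hS ⟨_, ((Multiset.replicate_mono g hle).trans hg), isTinyZS_replicate_addOrderOf g⟩

theorem exists_card_le_nsmul_sum_eq_zero {G : Type*} [AddCommGroup G] [Fintype G] {d d' : ℕ}
    (hd' : d' ∣ d) (hpos : 0 < d') {S : Multiset G} (hS : ∀ g ∈ S, d • g = 0)
    (hcard : etaDD G d' d ≤ Multiset.card S) :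
    ∃ S' ≤ S, S' ≠ 0 ∧ Multiset.card S' ≤ d' ∧ (d / d') • S'.sum = 0 := by
  refine (Nat.sInf_mem (s := {t : ℕ | 0 < t ∧ ∀ S : Multiset G, (∀ g ∈ S, d • g = 0) →
    t ≤ Multiset.card S → ∃ S' ≤ S, S' ≠ 0 ∧ Multiset.card S' ≤ d' ∧ (d / d') • S'.sum = 0})
    ⟨Fintype.card G * d', Nat.mul_pos Fintype.card_pos hpos, fun T hT hle => ?_⟩).2 S hS hcard
  obtain ⟨g, hg⟩ := exists_replicate_le_of_card_mul_le d' hle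
  refine ⟨_, hg, fun h => ?_, by simp, ?_⟩
  · have := congrArg Multiset.card h
    rw [Multiset.card_replicate, Multiset.card_zero] at this
    omega
  · have hmem : g ∈ T := Multiset.mem_of_le hg (Multiset.mem_replicate.mpr ⟨hpos.ne', rfl⟩)
    rw [Multiset.sum_replicate, ← mul_nsmul, mul_comm, Nat.div_mul_cancel hd', hT g hmem]

/-- Replacing a subsequence by its sum preserves the absence of tiny zero-sum subsequences,
provided the cross number does not decrease. -/
theorem not_exists_isTinyZS_sum_cons {G : Type*} [AddCommGroup G] {X R : Multiset G}
    (hX : crossNum X ≤ 1 / (addOrderOf X.sum : ℝ)) (hX0 : X ≠ 0)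
    (h : ¬ ∃ S' ≤ X + R, IsTinyZS S') : ¬ ∃ T' ≤ X.sum ::ₘ R, IsTinyZS T' := by
  rintro ⟨T, hT, hne, hsum, hk⟩
  by_cases hmem : X.sum ∈ T
  · obtain ⟨U, rfl⟩ := Multiset.exists_cons_of_mem hmem
    rw [Multiset.cons_le_cons_iff] at hT
    rw [Multiset.sum_cons] at hsum
    rw [crossNum_cons] at hk
    refine h ⟨X + U, by gcongr, fun h0 => hX0 (add_eq_zero.mp h0).1, by simpa using hsum, ?_⟩
    rw [crossNum_add]
    linarith
  · exact h ⟨T, ((Multiset.le_cons_of_notMem hmem).mp hT).trans (Multiset.le_add_left _ _),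
      hne, hsum, hk⟩


/-- If `S` is a sequence over `G` (of exponent `n`) containing no tiny zero-sum
subsequence, with `k(S) = ρ(G)`, and of minimal length among all such sequences, then for
all divisors `1 < d' ∣ d ∣ n`, the number of elements of order `d` in `S` is at most
`η_{(d',d)}(G) - 1`. -/
theorem stmt6 (G : Type*) [AddCommGroup G] [Fintype G]
    (n : ℕ) (hn : AddMonoid.exponent G = n)
    (S : Multiset G) (hS : ¬ ∃ S' ≤ S, IsTinyZS S')
    (hmax : crossNum S = rhoC G)
    (hmin : ∀ T : Multiset G, (¬ ∃ T' ≤ T, IsTinyZS T') → crossNum T = rhoC G →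
      Multiset.card S ≤ Multiset.card T)
    (d : ℕ) (hd : d ∣ n) (hd1 : 1 < d)
    (d' : ℕ) (hd' : d' ∣ d) (hd'1 : 1 < d') :
    Multiset.card (S.filter (fun g => addOrderOf g = d)) ≤ etaDD G d' d - 1 := by
  have hd0 : 0 < d := by omega
  by_contra! hlt
  obtain ⟨X, hXle, hX0, hXcard, hXsum⟩ := exists_card_le_nsmul_sum_eq_zero hd' (by omega)
    (S := S.filter fun g => addOrderOf g = d)
    (fun g hg => by rw [← (Multiset.mem_filter.mp hg).2, addOrderOf_nsmul_eq_zero]) (by omega)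
  have hord : ∀ g ∈ X, addOrderOf g = d := fun g hg =>
    (Multiset.mem_filter.mp (Multiset.mem_of_le hXle hg)).2
  obtain ⟨R, rfl⟩ := Multiset.le_iff_exists_add.mp (hXle.trans (Multiset.filter_le _ _))
  have hquot : 0 < d / d' := Nat.div_pos (Nat.le_of_dvd hd0 hd') (by omega)
  have hX1 : 1 < Multiset.card X := by
    by_contra! hle
    have hpos := Multiset.card_pos.mpr hX0
    obtain ⟨g, rfl⟩ := Multiset.card_eq_one.mp (le_antisymm hle hpos)
    rw [Multiset.sum_singleton] at hXsum
    have hdvd := addOrderOf_dvd_of_nsmul_eq_zero hXsum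
    rw [hord g (by simp)] at hdvd
    exact (Nat.le_of_dvd hquot hdvd).not_gt (Nat.div_lt_self hd0 hd'1)
  have hk : crossNum X ≤ 1 / (addOrderOf X.sum : ℝ) := by
    have hmul : Multiset.card X * addOrderOf X.sum ≤ d :=
      calc Multiset.card X * addOrderOf X.sum ≤ d' * (d / d') :=
            Nat.mul_le_mul hXcard
              (Nat.le_of_dvd hquot (addOrderOf_dvd_of_nsmul_eq_zero hXsum))
        _ = d := Nat.mul_div_cancel' hd'
    have hpos : (0 : ℝ) < addOrderOf X.sum := Nat.cast_pos.mpr (addOrderOf_pos _)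
    rw [crossNum_eq_of_addOrderOf_eq hord, mul_one_div, div_le_div_iff₀ (by positivity) hpos,
      one_mul]
    exact_mod_cast hmul
  have hT := not_exists_isTinyZS_sum_cons hk hX0 hS
  have hTle : crossNum (X.sum ::ₘ R) ≤ rhoC G := le_csSup bddAbove_crossNum ⟨_, hT, rfl⟩
  have hTeq : crossNum (X.sum ::ₘ R) = rhoC G := by
    refine le_antisymm hTle ?_
    rw [← hmax, crossNum_add, crossNum_cons]
    linarith
  have hcard := hmin _ hT hTeq
  rw [Multiset.card_add, Multiset.card_cons] at hcard
  omega
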